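/- There exist universal constants c, C > 0 such that for every β ≥ 1, every τ > 0 and every integer n ≥ 1, one has P_n^β({(x_1,…,x_n) : s_n < c·n^{−(2+τ)/β}}) < C·(n^{−τ} + e^{−nβ/C}). -/

import Mathlib

open MeasureTheory Filter Topology
open scoped ENNReal

/-- The (unnormalized) density of the Gaussian beta-ensemble with potential `x^2/2`. -/
noncomputable def gaussianDensity (n : ℕ) (β : ℝ) (x : Fin n → ℝ) : ℝ :=
  (∏ p ∈ Finset.univ.filter (fun p : Fin n × Fin n => p.1 < p.2), |x p.1 - x p.2| ^ β) *
    Real.exp (-((n : ℝ) * β / 2) * ∑ j, (x j) ^ 2 / 2)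

/-- The semicircle density. -/
noncomputable def semicircle (x : ℝ) : ℝ :=
  (2 * Real.pi)⁻¹ * Real.sqrt (max (4 - x ^ 2) 0)

/-- The regularized semicircle density. -/
noncomputable def semicircleReg (n : ℕ) (x : ℝ) : ℝ :=
  max (semicircle x) ((n : ℝ) ^ (-(1 : ℝ) / 3))

/-- Normalized minimal spacing of a configuration. -/
noncomputable def spacing (n : ℕ) (x : Fin n → ℝ) : ℝ :=
  sInf ((fun p : Fin n × Fin n => (n : ℝ) * semicircleReg n (x p.1) * |x p.1 - x p.2|) ''
    {p | p.1 ≠ p.2})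

/-- The product `∏ (z - a l)` over `l ∈ S`, weighted by the Gaussian `exp (-N z² / 4)`. -/
noncomputable def weightedProd {ι : Type*} (S : Finset ι) (a : ι → ℝ) (N : ℕ) (z : ℂ) : ℂ :=
  (∏ l ∈ S, (z - a l)) * Complex.exp (-(N / 4) * z ^ 2)

lemma differentiable_weightedProd {ι : Type*} (S : Finset ι) (a : ι → ℝ) (N : ℕ) :
    Differentiable ℂ (weightedProd S a N) := by
  unfold weightedProd
  fun_prop

lemma exists_two_mul_cos_eq (z : ℂ) : ∃ θ : ℂ, 0 ≤ θ.im ∧ z = 2 * Complex.cos θ := by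
  obtain ⟨θ, hθ⟩ := Complex.cos_surjective (z / 2)
  rcases le_total 0 θ.im with h | h
  · exact ⟨θ, h, by rw [hθ]; ring⟩
  · exact ⟨-θ, by simpa using h, by rw [Complex.cos_neg, hθ]; ring⟩

lemma re_two_mul_cos (θ : ℂ) :
    (2 * Complex.cos θ).re = 2 * (Real.cos θ.re * Real.cosh θ.im) := by
  rw [Complex.cos_eq]
  simp [← Complex.ofReal_cos, ← Complex.ofReal_sin, ← Complex.ofReal_cosh, ← Complex.ofReal_sinh]

lemma im_two_mul_cos (θ : ℂ) :
    (2 * Complex.cos θ).im = -(2 * (Real.sin θ.re * Real.sinh θ.im)) := by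
  rw [Complex.cos_eq]
  simp [← Complex.ofReal_cos, ← Complex.ofReal_sin, ← Complex.ofReal_cosh, ← Complex.ofReal_sinh]

/-- The entire function which turns `weightedProd` into a function bounded on the unit disc. -/
noncomputable def discLift {ι : Type*} (S : Finset ι) (a : ι → ℝ) (N : ℕ) (u : ℂ) : ℂ :=
  u * (∏ l ∈ S, (u ^ 2 + 1 - a l * u)) * Complex.exp (-(N / 2) * (u ^ 2 + 1))

lemma differentiable_discLift {ι : Type*} (S : Finset ι) (a : ι → ℝ) (N : ℕ) :
    Differentiable ℂ (discLift S a N) := by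
  unfold discLift
  fun_prop

lemma discLift_exp {ι : Type*} (S : Finset ι) (a : ι → ℝ) {N : ℕ} (hN : S.card + 1 = N) (θ : ℂ) :
    discLift S a N (Complex.exp (θ * Complex.I)) =
      weightedProd S a N (2 * Complex.cos θ) *
        Complex.exp (N * (θ * Complex.I - Complex.I * (Complex.sin θ * Complex.cos θ))) := by
  have hprod : ∏ l ∈ S, (Complex.exp (θ * Complex.I) ^ 2 + 1 - a l * Complex.exp (θ * Complex.I)) =
      Complex.exp (θ * Complex.I) ^ S.card * ∏ l ∈ S, (2 * Complex.cos θ - a l) := by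
    rw [← Finset.prod_const, ← Finset.prod_mul_distrib]
    refine Finset.prod_congr rfl fun l _ => ?_
    rw [Complex.two_cos]
    have : Complex.exp (θ * Complex.I) * Complex.exp (-θ * Complex.I) = 1 := by
      rw [← Complex.exp_add]; simp
    linear_combination -this
  have hexp : Complex.exp (θ * Complex.I) ^ N = Complex.exp (N * (θ * Complex.I)) := by
    rw [← Complex.exp_nat_mul]
  unfold discLift weightedProd
  rw [hprod]
  calc _ = Complex.exp (θ * Complex.I) ^ N * (∏ l ∈ S, (2 * Complex.cos θ - a l)) *
        Complex.exp (-(N / 2) * (Complex.exp (θ * Complex.I) ^ 2 + 1)) := by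
        rw [← hN]; ring
    _ = (∏ l ∈ S, (2 * Complex.cos θ - a l)) * (Complex.exp (N * (θ * Complex.I)) *
        Complex.exp (-(N / 2) * (Complex.exp (θ * Complex.I) ^ 2 + 1))) := by rw [hexp]; ring
    _ = _ := by
        rw [mul_assoc, ← Complex.exp_add, ← Complex.exp_add]
        congr 2
        rw [Complex.exp_mul_I]
        linear_combination (-(N:ℂ) / 2) * (Complex.sin θ) ^ 2 * Complex.I_sq +
          (N:ℂ) / 2 * Complex.sin_sq_add_cos_sq θ

lemma norm_discLift_exp {ι : Type*} (S : Finset ι) (a : ι → ℝ) {N : ℕ} (hN : S.card + 1 = N)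
    (θ : ℂ) :
    ‖discLift S a N (Complex.exp (θ * Complex.I))‖ =
      ‖weightedProd S a N (2 * Complex.cos θ)‖ * Real.exp (-(N * (θ.im -
        Real.sinh θ.im * Real.cosh θ.im * (1 - 2 * Real.sin θ.re ^ 2)))) := by
  rw [discLift_exp S a hN, norm_mul, Complex.norm_exp]
  congr 2
  rw [Complex.cos_eq, Complex.sin_eq]
  simp [← Complex.ofReal_cos, ← Complex.ofReal_sin, ← Complex.ofReal_cosh, ← Complex.ofReal_sinh]
  have := Real.sin_sq_add_cos_sq θ.re
  have h2 := Real.cosh_sq θ.im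
  linear_combination (N:ℝ) * Real.sinh θ.im * Real.cosh θ.im * this

/-- Bernstein–Walsh majorant for Gaussian weighted polynomials. -/
lemma exists_majorant {ι : Type*} (S : Finset ι) (a : ι → ℝ) {N : ℕ} (hN : S.card + 1 = N) :
    ∃ y : ℝ, |y| ≤ 2 ∧ ∀ θ : ℂ, 0 ≤ θ.im →
      ‖weightedProd S a N (2 * Complex.cos θ)‖ ≤ ‖weightedProd S a N y‖ *
        Real.exp (N * (θ.im - Real.sinh θ.im * Real.cosh θ.im * (1 - 2 * Real.sin θ.re ^ 2))) := by
  have hcont : ContinuousOn (fun y : ℝ => ‖weightedProd S a N y‖) (Set.Icc (-2) 2) := by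
    have := (differentiable_weightedProd S a N).continuous
    fun_prop
  obtain ⟨y, hy, hmax⟩ := isCompact_Icc.exists_isMaxOn
    (Set.nonempty_Icc.2 (by norm_num : (-2 : ℝ) ≤ 2)) hcont
  refine ⟨y, abs_le.2 hy, fun θ hθ => ?_⟩
  have hbd : ∀ u ∈ frontier (Metric.ball (0 : ℂ) 1),
      ‖discLift S a N u‖ ≤ ‖weightedProd S a N y‖ := by
    intro u hu
    rw [frontier_ball _ one_ne_zero, mem_sphere_zero_iff_norm] at hu
    have hu' : u = Complex.exp ((u.arg : ℂ) * Complex.I) := by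
      conv_lhs => rw [← Complex.norm_mul_exp_arg_mul_I u, hu]
      simp
    rw [hu', norm_discLift_exp S a hN]
    simp only [Complex.ofReal_im, Real.sinh_zero, zero_mul, sub_zero, mul_zero, neg_zero,
      Real.exp_zero, mul_one]
    have h := hmax (show 2 * Real.cos u.arg ∈ Set.Icc (-2 : ℝ) 2 from
      ⟨by linarith [Real.neg_one_le_cos u.arg], by linarith [Real.cos_le_one u.arg]⟩)
    simpa using h
  have hmem : Complex.exp (θ * Complex.I) ∈ closure (Metric.ball (0 : ℂ) 1) := by
    rw [closure_ball _ one_ne_zero, mem_closedBall_zero_iff, Complex.norm_exp]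
    simpa using hθ
  have h := Complex.norm_le_of_forall_mem_frontier_norm_le Metric.isBounded_ball
    (differentiable_discLift S a N).diffContOnCl hbd hmem
  rw [norm_discLift_exp S a hN, Real.exp_neg] at h
  rwa [mul_inv_le_iff₀ (Real.exp_pos _)] at h

lemma majorant_exponent_le {N x r b s c H K : ℝ} (hN : 0 ≤ N) (hx : |x| ≤ 7) (hr : 0 < r)
    (hσ : (N * r) ^ 2 * max (4 - x ^ 2) 0 ≤ 49) (hr3 : (N * r) ^ 2 * r ≤ 1)
    (hre : |2 * (c * K) - x| ≤ r) (him : |2 * (s * H)| ≤ r)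
    (hnorm : (2 * (c * K)) ^ 2 + (2 * (s * H)) ^ 2 ≤ 64)
    (hcs : s ^ 2 + c ^ 2 = 1) (hch : K ^ 2 = H ^ 2 + 1) (hb : 0 ≤ b) (hS : b ≤ H) (hC : 1 ≤ K) :
    N * (b - H * K * (1 - 2 * s ^ 2)) ≤ 17 := by
  have hH : 0 ≤ H := hb.trans hS
  set m := max (4 - x ^ 2) 0
  have hm : 4 - x ^ 2 ≤ m := le_max_left _ _
  have hm0 : 0 ≤ m := le_max_right _ _
  have hc2 : c ^ 2 = 1 - s ^ 2 := by linarith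
  have hs1 : s ^ 2 ≤ 1 := by nlinarith [sq_nonneg c]
  have hK : K ^ 2 ≤ 17 := by
    have : (2 * (c * K)) ^ 2 + (2 * (s * H)) ^ 2 = 4 * (K ^ 2 - s ^ 2) := by
      rw [mul_pow, mul_pow, mul_pow, mul_pow, hc2, hch]; ring
    linarith
  have hsH : (2 * (s * H)) ^ 2 ≤ r ^ 2 := sq_le_sq' (abs_le.1 him).1 (abs_le.1 him).2
  have hx2 : x ^ 2 - (2 * (c * K)) ^ 2 ≤ 15 * r := by
    have h8 : |2 * (c * K)| ≤ 8 := abs_le_of_sq_le_sq (by nlinarith [sq_nonneg (2 * (s * H))])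
      (by norm_num)
    calc x ^ 2 - (2 * (c * K)) ^ 2 = -((2 * (c * K) - x) * (x + 2 * (c * K))) := by ring
      _ ≤ |(2 * (c * K) - x) * (x + 2 * (c * K))| := neg_le_abs _
      _ = |2 * (c * K) - x| * |x + 2 * (c * K)| := abs_mul _ _
      _ ≤ r * 15 := by
        gcongr
        exact (abs_add_le _ _).trans (by linarith)
      _ = _ := by ring
  have hdiff : 4 * (s ^ 2 - H ^ 2) ≤ m + 15 * r := by
    have : 4 * (s ^ 2 - H ^ 2) = 4 - (2 * (c * K)) ^ 2 - (2 * (s * H)) ^ 2 := by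
      rw [mul_pow, mul_pow, mul_pow, mul_pow, hc2, hch]; ring
    nlinarith [sq_nonneg (2 * (s * H))]
  have hE : s ^ 2 ≤ m / 4 + 17 / 4 * r := by
    by_contra! h
    have h1 : r / 2 < H ^ 2 := by linarith
    have h2 : r / 2 < s ^ 2 := by linarith
    have h3 : r / 2 * (r / 2) < s ^ 2 * H ^ 2 := mul_lt_mul'' h2 h1 (by linarith) (by linarith)
    nlinarith
  have hle : N * (b - H * K * (1 - 2 * s ^ 2)) ≤ N * (2 * s ^ 2 * H * K) := by
    gcongr
    nlinarith [mul_nonneg hH (sub_nonneg.2 hC)]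
  refine hle.trans (le_of_abs_le (abs_le_of_sq_le_sq ?_ (by norm_num)))
  calc (N * (2 * s ^ 2 * H * K)) ^ 2 = N ^ 2 * (2 * (s * H)) ^ 2 * s ^ 2 * K ^ 2 := by ring
    _ ≤ N ^ 2 * r ^ 2 * (m / 4 + 17 / 4 * r) * 17 := by gcongr
    _ = ((N * r) ^ 2 * m / 4 + 17 / 4 * ((N * r) ^ 2 * r)) * 17 := by ring
    _ ≤ (49 / 4 + 17 / 4 * 1) * 17 := by gcongr
    _ ≤ 17 ^ 2 := by norm_num

/-- A weighted polynomial is controlled, near a real point, on discs of the size of the local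
spacing. -/
lemma norm_weightedProd_le_of_dist_le {ι : Type*} {S : Finset ι} {a : ι → ℝ} {N : ℕ} {M : ℝ}
    (hM0 : 0 ≤ M)
    (hM : ∀ θ : ℂ, 0 ≤ θ.im → ‖weightedProd S a N (2 * Complex.cos θ)‖ ≤ M *
        Real.exp (N * (θ.im - Real.sinh θ.im * Real.cosh θ.im * (1 - 2 * Real.sin θ.re ^ 2))))
    {x r : ℝ} (hx : |x| ≤ 7) (hr : 0 < r) (hr1 : r ≤ 1)
    (hσ : (N * r) ^ 2 * max (4 - x ^ 2) 0 ≤ 49) (hr3 : (N * r) ^ 2 * r ≤ 1) {z : ℂ}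
    (hz : dist z x ≤ r) : ‖weightedProd S a N z‖ ≤ M * Real.exp 17 := by
  obtain ⟨θ, hθ, rfl⟩ := exists_two_mul_cos_eq z
  refine (hM θ hθ).trans ?_
  gcongr
  have hre : |2 * (Real.cos θ.re * Real.cosh θ.im) - x| ≤ r := by
    refine le_trans ?_ hz
    rw [← re_two_mul_cos, dist_eq_norm]
    simpa using Complex.abs_re_le_norm (2 * Complex.cos θ - x)
  have him : |2 * (Real.sin θ.re * Real.sinh θ.im)| ≤ r := by
    refine le_trans ?_ hz
    rw [← abs_neg, ← im_two_mul_cos, dist_eq_norm]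
    simpa using Complex.abs_im_le_norm (2 * Complex.cos θ - x)
  have hnorm : (2 * (Real.cos θ.re * Real.cosh θ.im)) ^ 2 +
      (2 * (Real.sin θ.re * Real.sinh θ.im)) ^ 2 ≤ 64 := by
    have h1 : ‖2 * Complex.cos θ‖ ≤ 8 := by
      have h2 : ‖2 * Complex.cos θ‖ ≤ ‖2 * Complex.cos θ - x‖ + ‖(x : ℂ)‖ := by
        simpa using norm_add_le (2 * Complex.cos θ - x) (x : ℂ)
      rw [dist_eq_norm] at hz
      rw [Complex.norm_real, Real.norm_eq_abs] at h2
      linarith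
    have h3 := Complex.sq_norm (2 * Complex.cos θ)
    rw [Complex.normSq_apply, re_two_mul_cos, im_two_mul_cos] at h3
    nlinarith [norm_nonneg (2 * Complex.cos θ)]
  exact majorant_exponent_le (Nat.cast_nonneg N) hx hr hσ hr3 hre him hnorm
    (Real.sin_sq_add_cos_sq θ.re) (Real.cosh_sq θ.im) hθ (Real.self_le_sinh_iff.2 hθ)
    (Real.one_le_cosh θ.im)

lemma dist_weightedProd_le {ι : Type*} {S : Finset ι} {a : ι → ℝ} {N : ℕ} {M : ℝ}
    (hM0 : 0 ≤ M)
    (hM : ∀ θ : ℂ, 0 ≤ θ.im → ‖weightedProd S a N (2 * Complex.cos θ)‖ ≤ M *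
        Real.exp (N * (θ.im - Real.sinh θ.im * Real.cosh θ.im * (1 - 2 * Real.sin θ.re ^ 2))))
    {x r : ℝ} (hx : |x| ≤ 7) (hr : 0 < r) (hr1 : r ≤ 1)
    (hσ : (N * r) ^ 2 * max (4 - x ^ 2) 0 ≤ 49) (hr3 : (N * r) ^ 2 * r ≤ 1) {y : ℝ}
    (hy : |y - x| < r) :
    dist (weightedProd S a N y) (weightedProd S a N x) ≤ 2 * Real.exp 17 * M / r * |y - x| := by
  have hbd {z : ℂ} (hz : dist z x ≤ r) :=
    norm_weightedProd_le_of_dist_le hM0 hM hx hr hr1 hσ hr3 hz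
  have h := Complex.dist_le_div_mul_dist_of_mapsTo_ball (f := weightedProd S a N) (c := x)
    (R₁ := r) (R₂ := 2 * Real.exp 17 * M) (z := y)
    (differentiable_weightedProd S a N).differentiableOn
    (fun z hz => by
      rw [Metric.mem_closedBall, dist_eq_norm]
      have h1 := hbd (Metric.mem_ball.1 hz).le
      have h2 := hbd (z := x) (by simpa using hr.le)
      linarith [norm_sub_le (weightedProd S a N z) (weightedProd S a N x)])
    (by
      rw [Metric.mem_ball, dist_eq_norm, ← Complex.ofReal_sub, Complex.norm_real,
        Real.norm_eq_abs]
      exact hy)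
  rwa [dist_eq_norm (y : ℂ), ← Complex.ofReal_sub, Complex.norm_real, Real.norm_eq_abs] at h

lemma norm_weightedProd_le_of_six_lt {ι : Type*} {S : Finset ι} {a : ι → ℝ} {N : ℕ} {M : ℝ}
    (hM0 : 0 ≤ M)
    (hM : ∀ θ : ℂ, 0 ≤ θ.im → ‖weightedProd S a N (2 * Complex.cos θ)‖ ≤ M *
        Real.exp (N * (θ.im - Real.sinh θ.im * Real.cosh θ.im * (1 - 2 * Real.sin θ.re ^ 2))))
    {y : ℝ} (hy : 6 < |y|) :
    ‖weightedProd S a N y‖ ≤ M * Real.exp (-(N * (4 + y ^ 2 / 72))) := by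
  obtain ⟨θ, hθ, hyθ⟩ := exists_two_mul_cos_eq (y : ℂ)
  rw [hyθ]
  refine (hM θ hθ).trans ?_
  rw [← mul_neg]
  gcongr
  have hre : y = 2 * (Real.cos θ.re * Real.cosh θ.im) := by
    rw [← re_two_mul_cos, ← hyθ, Complex.ofReal_re]
  have him : Real.sin θ.re * Real.sinh θ.im = 0 := by
    have := im_two_mul_cos θ
    rw [← hyθ, Complex.ofReal_im] at this
    linarith
  have hcs := Real.sin_sq_add_cos_sq θ.re
  have hch := Real.cosh_sq θ.im
  have hS := Real.self_le_sinh_iff.2 hθ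
  have hC := Real.one_le_cosh θ.im
  have hy2 : 36 < y ^ 2 := by rw [← sq_abs]; nlinarith
  generalize Real.sin θ.re = s at *
  generalize Real.cos θ.re = c at *
  generalize Real.sinh θ.im = H at *
  generalize Real.cosh θ.im = K at *
  generalize θ.im = b at *
  have hs : s = 0 := by
    rcases mul_eq_zero.1 him with h | h
    · exact h
    · exfalso
      rw [hre, mul_pow, mul_pow, hch, h] at hy2
      nlinarith [sq_nonneg s]
  have hc : c ^ 2 = 1 := by nlinarith
  have hyK : y ^ 2 = 4 * K ^ 2 := by rw [hre, mul_pow, mul_pow, hc]; ring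
  have hK : 3 ≤ K := by nlinarith
  have hH : 2 / 3 * K ≤ H := by
    have hH0 : 0 ≤ H := hθ.trans hS
    by_contra! h
    nlinarith
  rw [hs, hyK]
  have h1 : 2 / 3 * K * (K - 1) ≤ H * (K - 1) := by gcongr
  nlinarith

lemma semicircleReg_pos {n : ℕ} (hn : 1 ≤ n) (x : ℝ) : 0 < semicircleReg n x :=
  lt_max_of_lt_right (by positivity)

lemma inv_mul_semicircleReg_bounds {n : ℕ} (hn : 1 ≤ n) (x : ℝ) :
    ((n : ℝ) * semicircleReg n x)⁻¹ ≤ 1 ∧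
    (n * ((n : ℝ) * semicircleReg n x)⁻¹) ^ 2 * max (4 - x ^ 2) 0 ≤ 49 ∧
    (n * ((n : ℝ) * semicircleReg n x)⁻¹) ^ 2 * ((n : ℝ) * semicircleReg n x)⁻¹ ≤ 1 := by
  have hσ := semicircleReg_pos hn x
  have hn' : (1 : ℝ) ≤ n := by exact_mod_cast hn
  have hn0 : (0 : ℝ) < n := by positivity
  have h3 : 1 ≤ n * semicircleReg n x ^ 3 := by
    calc (1 : ℝ) = n * ((n : ℝ) ^ (-(1 : ℝ) / 3)) ^ 3 := by
          rw [← Real.rpow_natCast, ← Real.rpow_mul hn0.le]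
          norm_num [Real.rpow_neg_one, hn0.ne']
      _ ≤ _ := by gcongr; exact le_max_right _ _
  have hsq : max (4 - x ^ 2) 0 ≤ 49 * semicircleReg n x ^ 2 := by
    have h1 : (2 * Real.pi)⁻¹ * Real.sqrt (max (4 - x ^ 2) 0) ≤ semicircleReg n x :=
      le_max_left _ _
    have hpi : 2 * Real.pi ≤ 7 := by linarith [Real.pi_lt_d2]
    rw [inv_mul_le_iff₀ (by positivity)] at h1
    calc max (4 - x ^ 2) 0 = Real.sqrt (max (4 - x ^ 2) 0) ^ 2 :=
          (Real.sq_sqrt (le_max_right _ _)).symm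
      _ ≤ (7 * semicircleReg n x) ^ 2 := by gcongr; exact h1.trans (by gcongr)
      _ = _ := by ring
  have hinv : n * ((n : ℝ) * semicircleReg n x)⁻¹ = (semicircleReg n x)⁻¹ := by
    field_simp
  rw [hinv]
  refine ⟨inv_le_one_of_one_le₀ ?_, ?_, ?_⟩
  · by_contra! h
    have h4 : semicircleReg n x ≤ n * semicircleReg n x := le_mul_of_one_le_left hσ.le hn'
    have h5 : semicircleReg n x ^ 2 ≤ 1 := pow_le_one₀ hσ.le (by linarith)
    nlinarith
  · rw [inv_pow, inv_mul_le_iff₀ (by positivity)]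
    linarith
  · rw [inv_pow, ← mul_inv]
    refine inv_le_one_of_one_le₀ ?_
    linarith

/-- The one-dimensional estimate: under the weight `|∏ (y - a l)| ^ β exp (-N β y² / 4)`, few
points `y` are close to one of the `a l`. -/
lemma lintegral_weightedProd_close_le {ι : Type*} (S : Finset ι) (a : ι → ℝ) {N : ℕ}
    (hN : S.card + 1 = N) {β : ℝ} (hβ : 1 ≤ β) {ε : ℝ} (hε0 : 0 ≤ ε) (hε : ε ≤ 1) (B : Set ℝ)
    (hB : ∀ y ∈ B, ∃ l ∈ S, N * semicircleReg N (a l) * |a l - y| < ε) :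
    ∫⁻ y : ℝ, B.indicator (fun y => ENNReal.ofReal (‖weightedProd S a N y‖ ^ β)) y ≤
      ENNReal.ofReal (2 * Real.exp 17 * N * 2 ^ β *
        (12 * (2 * Real.exp 17 * ε) ^ β + 16 * Real.exp (-(4 * (N * β))))) *
      ∫⁻ y : ℝ, ENNReal.ofReal (‖weightedProd S a N y‖ ^ β) := by
  obtain ⟨y₀, hy₀, hM⟩ := exists_majorant S a hN
  have hM0 : 0 ≤ ‖weightedProd S a N y₀‖ := norm_nonneg _
  set M := ‖weightedProd S a N y₀‖ with hMdef
  set A := 2 * Real.exp 17 with hA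
  have hA2 : 2 ≤ A := by linarith [Real.one_le_exp (show (0 : ℝ) ≤ 17 by norm_num)]
  have hN1 : 1 ≤ N := by omega
  have hN' : (1 : ℝ) ≤ N := by exact_mod_cast hN1
  have hβ0 : 0 < β := by linarith
  have hlow : ENNReal.ofReal ((M / 2) ^ β * (1 / (A * N))) ≤
      ∫⁻ y : ℝ, ENNReal.ofReal (‖weightedProd S a N y‖ ^ β) := by
    set δ := 1 / (2 * A * N)
    have hδ : δ < 1 / N := by
      simp only [δ]
      gcongr
      nlinarith
    have hvol : volume (Set.Icc (y₀ - δ) (y₀ + δ)) = ENNReal.ofReal (1 / (A * N)) := by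
      rw [Real.volume_Icc]
      congr 1
      simp only [δ]
      field_simp
      ring
    calc ENNReal.ofReal ((M / 2) ^ β * (1 / (A * N))) =
        ∫⁻ y : ℝ, (Set.Icc (y₀ - δ) (y₀ + δ)).indicator
          (fun _ => ENNReal.ofReal ((M / 2) ^ β)) y := by
          rw [lintegral_indicator_const measurableSet_Icc, hvol, ENNReal.ofReal_mul (by positivity)]
      _ ≤ _ := by
          refine lintegral_mono (Set.indicator_le fun y hy => ?_)
          have hyd : |y - y₀| ≤ δ := abs_le.2 ⟨by linarith [hy.1], by linarith [hy.2]⟩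
          have h := dist_weightedProd_le (x := y₀) (r := 1 / N) hM0 hM (by linarith) (by positivity)
            (by rw [div_le_one (by positivity)]; exact hN')
            (by
              rw [mul_one_div_cancel (by positivity)]
              have : max (4 - y₀ ^ 2) 0 ≤ 4 := max_le (by nlinarith [sq_nonneg y₀]) (by norm_num)
              linarith)
            (by
              rw [mul_one_div_cancel (by positivity), one_pow, one_mul,
                div_le_one (by positivity)]
              exact hN') (hyd.trans_lt hδ)
          have h2 : A * M / (1 / N) * |y - y₀| ≤ M / 2 := by
            calc A * M / (1 / N) * |y - y₀| ≤ A * M / (1 / N) * δ := by gcongr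
              _ = M / 2 := by simp only [δ]; field_simp
          have h3 : M ≤ ‖weightedProd S a N y‖ +
              dist (weightedProd S a N y) (weightedProd S a N y₀) := by
            rw [dist_comm, dist_eq_norm]
            linarith [norm_sub_norm_le (weightedProd S a N y₀) (weightedProd S a N y)]
          gcongr
          linarith
  have hup : ∫⁻ y : ℝ, B.indicator (fun y => ENNReal.ofReal (‖weightedProd S a N y‖ ^ β)) y ≤
      ENNReal.ofReal (M ^ β * (12 * (A * ε) ^ β + 16 * Real.exp (-(4 * (N * β))))) := by
    have hgauss : ∫⁻ y : ℝ, ENNReal.ofReal (Real.exp (-(1 / 72) * y ^ 2)) ≤ ENNReal.ofReal 16 := by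
      rw [← ofReal_integral_eq_lintegral_ofReal (integrable_exp_neg_mul_sq (by norm_num))
        (Eventually.of_forall fun _ => (Real.exp_pos _).le), integral_gaussian]
      gcongr
      rw [Real.sqrt_le_left (by norm_num)]
      linarith [Real.pi_lt_d2]
    calc _ ≤ ∫⁻ y : ℝ, ((Set.Icc (-6 : ℝ) 6).indicator
            (fun _ => ENNReal.ofReal (M ^ β * (A * ε) ^ β)) y +
            ENNReal.ofReal (M ^ β * Real.exp (-(4 * (N * β)))) *
              ENNReal.ofReal (Real.exp (-(1 / 72) * y ^ 2))) := by
          refine lintegral_mono (Set.indicator_le fun y hy => ?_)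
          obtain ⟨l, hl, hly⟩ := hB y hy
          by_cases hy6 : |y| ≤ 6
          · rw [Set.indicator_of_mem (by simpa [abs_le] using hy6)]
            refine le_add_right (ENNReal.ofReal_le_ofReal ?_)
            rw [← Real.mul_rpow hM0 (by positivity)]
            gcongr
            obtain ⟨hr1, hr2, hr3⟩ := inv_mul_semicircleReg_bounds hN1 (a l)
            have hσ := semicircleReg_pos hN1 (a l)
            have hr0 : 0 < ((N : ℝ) * semicircleReg N (a l))⁻¹ := by positivity
            have hly' : |y - a l| < ((N : ℝ) * semicircleReg N (a l))⁻¹ * ε := by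
              rw [abs_sub_comm]
              rwa [← div_eq_inv_mul, lt_div_iff₀' (by positivity)]
            set r := ((N : ℝ) * semicircleReg N (a l))⁻¹
            have hly1 : |y - a l| < r := hly'.trans_le (mul_le_of_le_one_right hr0.le hε)
            have hzero : weightedProd S a N (a l) = 0 := by
              unfold weightedProd
              rw [Finset.prod_eq_zero hl (sub_self _), zero_mul]
            have h7 : |a l| ≤ 7 := by
              have : |a l| ≤ |y| + |y - a l| := by
                rw [abs_sub_comm]
                simpa using abs_add_le y (a l - y)
              linarith
            have h := dist_weightedProd_le hM0 hM h7 hr0 hr1 hr2 hr3 hly1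
            rw [hzero, dist_zero_right] at h
            refine h.trans ?_
            calc A * M / r * |y - a l| ≤ A * M / r * (r * ε) := by gcongr
              _ = M * (A * ε) := by field_simp
          · refine le_add_left ?_
            rw [← ENNReal.ofReal_mul (by positivity)]
            refine ENNReal.ofReal_le_ofReal ?_
            calc ‖weightedProd S a N y‖ ^ β ≤ (M * Real.exp (-(N * (4 + y ^ 2 / 72)))) ^ β := by
                  gcongr
                  exact norm_weightedProd_le_of_six_lt hM0 hM (not_le.1 hy6)
              _ = M ^ β * (Real.exp (-(4 * (N * β))) * Real.exp (-(N * β * (y ^ 2 / 72)))) := by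
                  rw [Real.mul_rpow hM0 (Real.exp_pos _).le, ← Real.exp_mul, ← Real.exp_add]
                  congr 2
                  ring
              _ ≤ M ^ β * (Real.exp (-(4 * (N * β))) * Real.exp (-(1 / 72) * y ^ 2)) := by
                  gcongr
                  have : 1 ≤ N * β := one_le_mul_of_one_le_of_one_le hN' hβ
                  nlinarith [mul_nonneg (sub_nonneg.2 this) (sq_nonneg y)]
              _ = _ := by ring
      _ ≤ ENNReal.ofReal (M ^ β * (A * ε) ^ β) * ENNReal.ofReal 12 +
            ENNReal.ofReal (M ^ β * Real.exp (-(4 * (N * β)))) * ENNReal.ofReal 16 := by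
          rw [lintegral_add_left (measurable_const.indicator measurableSet_Icc),
            lintegral_indicator_const measurableSet_Icc, Real.volume_Icc,
            lintegral_const_mul' _ _ ENNReal.ofReal_ne_top]
          gcongr
          norm_num
      _ = _ := by
          rw [← ENNReal.ofReal_mul (by positivity), ← ENNReal.ofReal_mul (by positivity),
            ← ENNReal.ofReal_add (by positivity) (by positivity)]
          congr 1
          ring
  refine hup.trans (le_trans (le_of_eq ?_) (mul_le_mul_right hlow _))
  rw [← ENNReal.ofReal_mul (by positivity), Real.div_rpow hM0 (by norm_num)]
  congr 1
  field_simp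

lemma norm_weightedProd_ofReal {ι : Type*} (S : Finset ι) (a : ι → ℝ) (N : ℕ) (y : ℝ) :
    ‖weightedProd S a N y‖ = (∏ l ∈ S, |y - a l|) * Real.exp (-(N / 4) * y ^ 2) := by
  unfold weightedProd
  rw [norm_mul, norm_prod, Complex.norm_exp]
  congr 2
  · ext l
    rw [← Complex.ofReal_sub, Complex.norm_real, Real.norm_eq_abs]
  · rw [← Complex.ofReal_re (-(N / 4) * y ^ 2)]
    push_cast
    rfl

/-- As a function of one coordinate, the density is a power of a weighted polynomial. -/
lemma exists_gaussianDensity_update_eq {n : ℕ} (β : ℝ) (x : Fin n → ℝ) (k : Fin n) :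
    ∃ R : ℝ, 0 ≤ R ∧ ∀ y : ℝ, gaussianDensity n β (Function.update x k y) =
      R * ‖weightedProd (Finset.univ.erase k) x n y‖ ^ β := by
  set P := Finset.univ.filter (fun p : Fin n × Fin n => p.1 < p.2)
  refine ⟨(∏ p ∈ P with ¬(p.1 = k ∨ p.2 = k), |x p.1 - x p.2| ^ β) *
    Real.exp (-((n : ℝ) * β / 2) * ∑ j ∈ Finset.univ.erase k, (x j) ^ 2 / 2), ?_, fun y => ?_⟩
  · exact mul_nonneg (Finset.prod_nonneg fun p _ => Real.rpow_nonneg (abs_nonneg _) _)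
      (Real.exp_pos _).le
  rw [norm_weightedProd_ofReal, Real.mul_rpow (Finset.prod_nonneg fun _ _ => abs_nonneg _)
    (Real.exp_pos _).le, ← Real.finsetProd_rpow _ _ fun _ _ => abs_nonneg _, ← Real.exp_mul]
  have hsum : ∑ j, (Function.update x k y j) ^ 2 / 2 =
      y ^ 2 / 2 + ∑ j ∈ Finset.univ.erase k, (x j) ^ 2 / 2 := by
    rw [← Finset.add_sum_erase _ _ (Finset.mem_univ k), Function.update_self]
    congr 1
    refine Finset.sum_congr rfl fun j hj => ?_
    rw [Function.update_of_ne (Finset.ne_of_mem_erase hj)]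
  have hpair : ∏ p ∈ P with (p.1 = k ∨ p.2 = k),
      |Function.update x k y p.1 - Function.update x k y p.2| ^ β =
      ∏ l ∈ Finset.univ.erase k, |y - x l| ^ β := by
    symm
    refine Finset.prod_bij (fun l _ => if l < k then (l, k) else (k, l)) ?_ ?_ ?_ ?_
    · intro l hl
      have := Finset.ne_of_mem_erase hl
      split_ifs with h
      · simp [P, h]
      · simp [P, lt_of_le_of_ne (not_lt.1 h) this.symm]
    · intro l hl m hm h
      have := Finset.ne_of_mem_erase hl
      have := Finset.ne_of_mem_erase hm
      split_ifs at h <;> simp_all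
    · rintro ⟨p, q⟩ hpq
      simp only [P, Finset.mem_filter, Finset.mem_univ, true_and] at hpq
      obtain ⟨hlt, rfl | rfl⟩ := hpq
      · exact ⟨q, by simp [hlt.ne'], by simp [hlt.le]⟩
      · exact ⟨p, by simp [hlt.ne], by simp [hlt]⟩
    · intro l hl
      have hlk := Finset.ne_of_mem_erase hl
      split_ifs with h
      · simp [Function.update_of_ne hlk, abs_sub_comm]
      · simp [Function.update_of_ne hlk]
  have hrest : ∏ p ∈ P with ¬(p.1 = k ∨ p.2 = k),
      |Function.update x k y p.1 - Function.update x k y p.2| ^ β =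
      ∏ p ∈ P with ¬(p.1 = k ∨ p.2 = k), |x p.1 - x p.2| ^ β := by
    refine Finset.prod_congr rfl fun p hp => ?_
    obtain ⟨-, hp⟩ := Finset.mem_filter.1 hp
    rw [not_or] at hp
    rw [Function.update_of_ne hp.1, Function.update_of_ne hp.2]
  unfold gaussianDensity
  rw [← Finset.prod_filter_mul_prod_filter_not P (fun p => p.1 = k ∨ p.2 = k), hpair, hrest, hsum,
    mul_add, Real.exp_add]
  ring_nf

lemma measurable_gaussianDensity (n : ℕ) (β : ℝ) : Measurable (gaussianDensity n β) := by
  unfold gaussianDensity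
  fun_prop

lemma measurable_semicircleReg (n : ℕ) : Measurable (semicircleReg n) := by
  unfold semicircleReg semicircle
  fun_prop

lemma measurableSet_close (n : ℕ) (k : Fin n) (ε : ℝ) :
    MeasurableSet {x : Fin n → ℝ | ∃ l, l ≠ k ∧ n * semicircleReg n (x l) * |x l - x k| < ε} := by
  have h := measurable_semicircleReg n
  rw [show {x : Fin n → ℝ | ∃ l, l ≠ k ∧ n * semicircleReg n (x l) * |x l - x k| < ε} =
    ⋃ l, {x : Fin n → ℝ | l ≠ k ∧ n * semicircleReg n (x l) * |x l - x k| < ε} by ext; simp]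
  refine MeasurableSet.iUnion fun l => ?_
  refine (MeasurableSet.const (l ≠ k)).inter ?_
  have hg : Measurable fun x : Fin n → ℝ => n * semicircleReg n (x l) * |x l - x k| := by fun_prop
  exact measurableSet_lt hg measurable_const

lemma withDensity_close_le {n : ℕ} {β ε Z : ℝ} (hβ : 1 ≤ β) (hε0 : 0 ≤ ε) (hε : ε ≤ 1)
    (hZ : 0 < Z) (k : Fin n) :
    (volume.withDensity (fun x => ENNReal.ofReal (gaussianDensity n β x / Z)))
        {x : Fin n → ℝ | ∃ l, l ≠ k ∧ n * semicircleReg n (x l) * |x l - x k| < ε} ≤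
      ENNReal.ofReal (2 * Real.exp 17 * n * 2 ^ β *
        (12 * (2 * Real.exp 17 * ε) ^ β + 16 * Real.exp (-(4 * (n * β))))) *
      (volume.withDensity (fun x => ENNReal.ofReal (gaussianDensity n β x / Z))) Set.univ := by
  set Kc := ENNReal.ofReal (2 * Real.exp 17 * n * 2 ^ β *
        (12 * (2 * Real.exp 17 * ε) ^ β + 16 * Real.exp (-(4 * (n * β)))))
  have hf : Measurable fun x : Fin n → ℝ => ENNReal.ofReal (gaussianDensity n β x / Z) :=
    ((measurable_gaussianDensity n β).div_const Z).ennreal_ofReal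
  have hB := measurableSet_close n k ε
  rw [withDensity_apply _ hB, withDensity_apply _ MeasurableSet.univ, Measure.restrict_univ,
    ← lintegral_indicator hB, ← lintegral_const_mul _ hf, volume_pi]
  refine lintegral_le_of_lmarginal_le {k} (hf.indicator hB) (hf.const_mul Kc) fun x => ?_
  rw [lmarginal_singleton, lmarginal_singleton]
  obtain ⟨R, hR, hRy⟩ := exists_gaussianDensity_update_eq β x k
  have hcard : (Finset.univ.erase k).card + 1 = n := by
    rw [Finset.card_erase_add_one (Finset.mem_univ k), Finset.card_univ, Fintype.card_fin]
  have hfy (y : ℝ) : ENNReal.ofReal (gaussianDensity n β (Function.update x k y) / Z) =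
      ENNReal.ofReal (R / Z) *
        ENNReal.ofReal (‖weightedProd (Finset.univ.erase k) x n y‖ ^ β) := by
    rw [hRy, ← ENNReal.ofReal_mul (by positivity)]
    congr 1
    ring
  have hclose := lintegral_weightedProd_close_le (Finset.univ.erase k) x hcard hβ hε0 hε
    {y | ∃ l ∈ Finset.univ.erase k, n * semicircleReg n (x l) * |x l - y| < ε} fun y hy => hy
  calc _ = ENNReal.ofReal (R / Z) * ∫⁻ y : ℝ,
        {y | ∃ l ∈ Finset.univ.erase k, n * semicircleReg n (x l) * |x l - y| < ε}.indicator
          (fun y => ENNReal.ofReal (‖weightedProd (Finset.univ.erase k) x n y‖ ^ β)) y := by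
        rw [← lintegral_const_mul' _ _ ENNReal.ofReal_ne_top]
        refine lintegral_congr fun y => ?_
        have hiff : Function.update x k y ∈
            {x : Fin n → ℝ | ∃ l, l ≠ k ∧ n * semicircleReg n (x l) * |x l - x k| < ε} ↔
            y ∈ {y | ∃ l ∈ Finset.univ.erase k, n * semicircleReg n (x l) * |x l - y| < ε} := by
          simp only [Set.mem_ofPred_eq, Finset.mem_erase, Finset.mem_univ, and_true]
          refine exists_congr fun l => and_congr_right fun hl => ?_
          rw [Function.update_of_ne hl, Function.update_self]
        by_cases hy : y ∈ {y | ∃ l ∈ Finset.univ.erase k,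
            n * semicircleReg n (x l) * |x l - y| < ε}
        · rw [Set.indicator_of_mem (hiff.2 hy), Set.indicator_of_mem hy, hfy]
        · rw [Set.indicator_of_notMem (mt hiff.1 hy), Set.indicator_of_notMem hy, mul_zero]
    _ ≤ ENNReal.ofReal (R / Z) * (Kc * ∫⁻ y : ℝ,
          ENNReal.ofReal (‖weightedProd (Finset.univ.erase k) x n y‖ ^ β)) := by gcongr
    _ = _ := by
        simp_rw [hfy]
        rw [lintegral_const_mul' _ _ ENNReal.ofReal_ne_top,
          lintegral_const_mul' _ _ ENNReal.ofReal_ne_top]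
        ring

lemma setOf_spacing_lt_subset {n : ℕ} (hn : 2 ≤ n) (ε : ℝ) :
    {x | spacing n x < ε} ⊆
      ⋃ k, {x : Fin n → ℝ | ∃ l, l ≠ k ∧ n * semicircleReg n (x l) * |x l - x k| < ε} := by
  intro x hx
  have hx' : spacing n x < ε := hx
  have hne : ({p | p.1 ≠ p.2} : Set (Fin n × Fin n)).Nonempty :=
    ⟨(⟨0, by omega⟩, ⟨1, by omega⟩), by simp⟩
  obtain ⟨_, ⟨p, hp, rfl⟩, hlt⟩ := exists_lt_of_csInf_lt (hne.image _) hx'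
  exact Set.mem_iUnion.2 ⟨p.2, p.1, hp, hlt⟩

lemma two_rpow_mul_sq_mul_exp_le {n : ℕ} {β : ℝ} (hn : 1 ≤ n) (hβ : 1 ≤ β) :
    2 ^ β * (n : ℝ) ^ 2 * Real.exp (-(4 * (n * β))) ≤ 4 * Real.exp (-(2 * (n * β))) := by
  have hn' : (1 : ℝ) ≤ n := by exact_mod_cast hn
  have h1 : (2 : ℝ) ^ β ≤ Real.exp (n * β) := by
    calc (2 : ℝ) ^ β ≤ Real.exp 1 ^ β := by
          gcongr
          linarith [Real.add_one_le_exp 1]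
      _ = Real.exp (1 * β) := (Real.exp_mul _ _).symm
      _ ≤ _ := by gcongr
  have h2 : (n : ℝ) ^ 2 ≤ 4 * Real.exp (n * β) := by
    have h3 : (n : ℝ) / 2 ≤ Real.exp (n / 2) := by linarith [Real.add_one_le_exp ((n : ℝ) / 2)]
    calc (n : ℝ) ^ 2 = 4 * (n / 2 : ℝ) ^ 2 := by ring
      _ ≤ 4 * Real.exp (n / 2) ^ 2 := by gcongr
      _ = 4 * Real.exp (n * 1) := by rw [← Real.exp_nat_mul]; congr 2; push_cast; ring
      _ ≤ _ := by gcongr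
  calc 2 ^ β * (n : ℝ) ^ 2 * Real.exp (-(4 * (n * β))) ≤
      Real.exp (n * β) * (4 * Real.exp (n * β)) * Real.exp (-(4 * (n * β))) := by gcongr
    _ = 4 * (Real.exp (n * β) * Real.exp (n * β) * Real.exp (-(4 * (n * β)))) := by ring
    _ = _ := by rw [← Real.exp_add, ← Real.exp_add]; congr 2; ring

/-- Separation estimate for the Gaussian beta-ensemble. -/
theorem separation_estimate :
    ∃ c C : ℝ, 0 < c ∧ 0 < C ∧
      ∀ β : ℝ, 1 ≤ β → ∀ τ : ℝ, 0 < τ → ∀ n : ℕ, 1 ≤ n →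
        ∀ Z : ℝ, 0 < Z →
        ∀ μ : Measure (Fin n → ℝ),
          μ = volume.withDensity (fun x => ENNReal.ofReal (gaussianDensity n β x / Z)) →
          IsProbabilityMeasure μ →
          μ {x | spacing n x < c * (n : ℝ) ^ (-(2 + τ) / β)} <
            ENNReal.ofReal (C * ((n : ℝ) ^ (-τ) + Real.exp (-((n : ℝ) * β) / C))) := by
  set A : ℝ := 2 * Real.exp 17 with hA
  have hA2 : 2 ≤ A := by linarith [Real.one_le_exp (show (0 : ℝ) ≤ 17 by norm_num)]
  refine ⟨(2 * A)⁻¹, 200 * A, by positivity, by positivity, ?_⟩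
  intro β hβ τ hτ n hn Z hZ μ hμ hprob
  have hn' : (1 : ℝ) ≤ n := by exact_mod_cast hn
  have hn0 : (0 : ℝ) < n := by positivity
  have hβ0 : 0 < β := by linarith
  rcases hn.eq_or_lt with rfl | hn2
  · refine prob_le_one.trans_lt ?_
    rw [← ENNReal.ofReal_one]
    refine (ENNReal.ofReal_lt_ofReal_iff (by positivity)).2 ?_
    rw [Nat.cast_one, Real.one_rpow]
    nlinarith [Real.exp_pos (-(1 * β) / (200 * A))]
  set ε := (2 * A)⁻¹ * (n : ℝ) ^ (-(2 + τ) / β) with hεdef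
  have hpow : (n : ℝ) ^ (-(2 + τ) / β) ≤ 1 :=
    Real.rpow_le_one_of_one_le_of_nonpos hn'
      (div_nonpos_of_nonpos_of_nonneg (by linarith) hβ0.le)
  have hε0 : 0 ≤ ε := by positivity
  have hε1 : ε ≤ 1 := mul_le_one₀ (inv_le_one_of_one_le₀ (by linarith)) (by positivity) hpow
  have hεβ : 2 ^ β * (A * ε) ^ β = (n : ℝ) ^ (-(2 + τ)) := by
    rw [← Real.mul_rpow (by norm_num) (by positivity)]
    rw [show 2 * (A * ε) = (n : ℝ) ^ (-(2 + τ) / β) by rw [hεdef]; field_simp,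
      ← Real.rpow_mul hn0.le, div_mul_cancel₀ _ hβ0.ne']
  have hnτ : (n : ℝ) ^ 2 * (n : ℝ) ^ (-(2 + τ)) = (n : ℝ) ^ (-τ) := by
    rw [← Real.rpow_natCast, ← Real.rpow_add hn0]
    congr 1
    push_cast
    ring
  set K := A * n * 2 ^ β * (12 * (A * ε) ^ β + 16 * Real.exp (-(4 * (n * β)))) with hK
  have hKpos : 0 ≤ K := by positivity
  have hunion : μ {x | spacing n x < ε} ≤ ENNReal.ofReal (n * K) := by
    calc μ {x | spacing n x < ε} ≤ μ (⋃ k, {x : Fin n → ℝ |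
          ∃ l, l ≠ k ∧ n * semicircleReg n (x l) * |x l - x k| < ε}) :=
          measure_mono (setOf_spacing_lt_subset hn2 ε)
      _ ≤ ∑ k : Fin n, μ {x : Fin n → ℝ |
          ∃ l, l ≠ k ∧ n * semicircleReg n (x l) * |x l - x k| < ε} :=
          measure_iUnion_fintype_le _ _
      _ ≤ ∑ _k : Fin n, ENNReal.ofReal K := by
          refine Finset.sum_le_sum fun k _ => ?_
          have h := withDensity_close_le hβ hε0 hε1 hZ k
          rwa [← hμ, measure_univ, mul_one] at h
      _ = _ := by
          rw [Finset.sum_const, Finset.card_univ, Fintype.card_fin, nsmul_eq_mul,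
            ENNReal.ofReal_mul hn0.le, ENNReal.ofReal_natCast]
  refine hunion.trans_lt ((ENNReal.ofReal_lt_ofReal_iff (by positivity)).2 ?_)
  have hexp : Real.exp (-(2 * (n * β))) ≤ Real.exp (-((n : ℝ) * β) / (200 * A)) := by
    refine Real.exp_le_exp.2 ?_
    rw [le_div_iff₀ (by positivity)]
    nlinarith [mul_pos hn0 hβ0]
  have hnK : n * K = 12 * A * (n : ℝ) ^ (-τ) +
      16 * A * (2 ^ β * (n : ℝ) ^ 2 * Real.exp (-(4 * (n * β)))) := by
    rw [← hnτ, ← hεβ, hK]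
    ring
  calc n * K ≤ 12 * A * (n : ℝ) ^ (-τ) +
        16 * A * (4 * Real.exp (-((n : ℝ) * β) / (200 * A))) := by
        rw [hnK]
        have h := (two_rpow_mul_sq_mul_exp_le hn hβ).trans
          (mul_le_mul_of_nonneg_left hexp (by norm_num))
        exact add_le_add_right (mul_le_mul_of_nonneg_left h (by positivity)) _
    _ < 200 * A * ((n : ℝ) ^ (-τ) + Real.exp (-((n : ℝ) * β) / (200 * A))) := by
        have h1 : 0 < A * (n : ℝ) ^ (-τ) := by positivity
        have h2 : 0 < A * Real.exp (-((n : ℝ) * β) / (200 * A)) := by positivity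
        nlinarith
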